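/- arXiv:2603.13207 — 2 statements merged into one kernel-verified Lean document; each statement's English description precedes it below -/
import Mathlib

section
/- Dirichlet integral identity: for a finite index set D, a vector a : D → ℝ with a(i) > 0 for all i, α = Σ_i a(i), and Z > 0, the integral of ∏_i p(i)^{a(i)-1}/Γ(a(i)) over the simplex {p : D → ℝ≥0 : Σ_i p(i) = Z} (with respect to the (|D|-1)-dimensional Lebesgue measure on the simplex) equals Z^{α-1}/Γ(α). -/
open MeasureTheory Real

/-- The normalised power density, extended by zero to negative reals. -/
noncomputable def dgDens (s x : ℝ) : ℝ := if 0 ≤ x then x ^ (s - 1) / Real.Gamma s else 0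

lemma dgDens_nonneg {s : ℝ} (hs : 0 < s) (x : ℝ) : 0 ≤ dgDens s x := by
  unfold dgDens
  have := Real.Gamma_pos_of_pos hs
  split_ifs <;> positivity

lemma measurable_dgDens (s : ℝ) : Measurable (dgDens s) :=
  Measurable.ite measurableSet_Ici (by fun_prop) (by fun_prop)

lemma dg_beta {s t z : ℝ} (hs : 0 < s) (ht : 0 < t) (hz : 0 < z) :
    ∫ x in (0 : ℝ)..z, x ^ (s - 1) * (z - x) ^ (t - 1) =
      z ^ (s + t - 1) * (Real.Gamma s * Real.Gamma t / Real.Gamma (s + t)) := by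
  have h := Complex.betaIntegral_scaled (s : ℂ) (t : ℂ) hz
  rw [Complex.betaIntegral_eq_Gamma_mul_div _ _ (by simpa) (by simpa)] at h
  have h2 : ∫ x in (0 : ℝ)..z, (x : ℂ) ^ ((s : ℂ) - 1) * ((z : ℂ) - x) ^ ((t : ℂ) - 1) =
      ∫ x in (0 : ℝ)..z, ((x ^ (s - 1) * (z - x) ^ (t - 1) : ℝ) : ℂ) := by
    apply intervalIntegral.integral_congr
    intro x hx
    rw [Set.uIcc_of_le hz.le] at hx
    simp only
    rw [Complex.ofReal_mul, Complex.ofReal_cpow hx.1, Complex.ofReal_cpow (by linarith [hx.2])]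
    push_cast
    rfl
  rw [h2, intervalIntegral.integral_ofReal, ← Complex.ofReal_add, Complex.Gamma_ofReal,
    Complex.Gamma_ofReal, Complex.Gamma_ofReal, ← Complex.ofReal_one, ← Complex.ofReal_sub,
    ← Complex.ofReal_cpow hz.le] at h
  exact_mod_cast h

lemma dg_conv {s t z : ℝ} (hs : 0 < s) (ht : 0 < t) (hz : z ≠ 0) :
    ∫⁻ x, ENNReal.ofReal (dgDens s x) * ENNReal.ofReal (dgDens t (z - x)) =
      ENNReal.ofReal (dgDens (s + t) z) := by
  have hGs := Real.Gamma_pos_of_pos hs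
  have hGt := Real.Gamma_pos_of_pos ht
  have hG := Real.Gamma_pos_of_pos (add_pos hs ht)
  simp_rw [← ENNReal.ofReal_mul (dgDens_nonneg hs _)]
  rcases lt_or_gt_of_ne hz with hz | hz
  · have : ∀ x, dgDens s x * dgDens t (z - x) = 0 := by
      intro x
      unfold dgDens
      by_cases h : 0 ≤ x
      · rw [if_neg (show ¬ 0 ≤ z - x by linarith), mul_zero]
      · rw [if_neg h, zero_mul]
    simp_rw [this]
    simp [dgDens, hz.not_ge]
  · have key : ∫ x, dgDens s x * dgDens t (z - x) = dgDens (s + t) z := by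
      have : ∀ x, dgDens s x * dgDens t (z - x) = (Set.Icc 0 z).indicator
          (fun x => (x ^ (s - 1) * (z - x) ^ (t - 1)) / (Real.Gamma s * Real.Gamma t)) x := by
        intro x
        unfold dgDens
        by_cases h : 0 ≤ x
        · by_cases h' : x ≤ z
          · rw [if_pos h, if_pos (sub_nonneg.2 h'), Set.indicator_of_mem (Set.mem_Icc.2 ⟨h, h'⟩)]
            field_simp
          · rw [if_neg (show ¬ 0 ≤ z - x by linarith), mul_zero,
              Set.indicator_of_notMem (fun hh => h' hh.2)]
        · rw [if_neg h, zero_mul, Set.indicator_of_notMem (fun hh => h hh.1)]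
      simp_rw [this]
      rw [integral_indicator measurableSet_Icc, integral_Icc_eq_integral_Ioc,
        ← intervalIntegral.integral_of_le hz.le, intervalIntegral.integral_div, dg_beta hs ht hz,
        dgDens, if_pos hz.le]
      field_simp
    have hint : Integrable (fun x => dgDens s x * dgDens t (z - x)) := by
      by_contra hn
      rw [integral_undef hn, dgDens, if_pos hz.le] at key
      have : 0 < z ^ (s + t - 1) / Real.Gamma (s + t) := by positivity
      linarith
    rw [← ofReal_integral_eq_lintegral_ofReal hint
      (ae_of_all _ fun x => mul_nonneg (dgDens_nonneg hs _) (dgDens_nonneg ht _)), key]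

lemma dg_fin (n : ℕ) : ∀ (a : Fin n → ℝ) (_ : ∀ i, 0 < a i) (b : ℝ) (_ : 0 < b) (z : ℝ)
    (_ : z ≠ 0),
    ∫⁻ q : Fin n → ℝ, (∏ i, ENNReal.ofReal (dgDens (a i) (q i))) *
      ENNReal.ofReal (dgDens b (z - ∑ i, q i)) = ENNReal.ofReal (dgDens (b + ∑ i, a i) z) := by
  induction n with
  | zero =>
    intro a ha b hb z hz
    simp [lintegral_unique, Measure.volume_pi_eq_dirac (0 : Fin 0 → ℝ)]
  | succ n ih =>
    intro a ha b hb z hz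
    have hm : ∀ s, Measurable fun x => ENNReal.ofReal (dgDens s x) :=
      fun s => (measurable_dgDens s).ennreal_ofReal
    have hS : 0 < b + ∑ i : Fin n, a i.succ :=
      add_pos_of_pos_of_nonneg hb (Finset.sum_nonneg fun i _ => (ha _).le)
    rw [← (volume_preserving_piFinSuccAbove (fun _ : Fin (n + 1) => ℝ) 0).symm.lintegral_comp_emb
      (MeasurableEquiv.measurableEmbedding _)]
    simp only [MeasurableEquiv.piFinSuccAbove_symm_apply, Fin.insertNthEquiv_apply,
      Fin.prod_univ_succ, Fin.sum_univ_succ, Fin.insertNth_zero, Fin.cons_zero, Fin.cons_succ]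
    rw [Measure.volume_eq_prod, lintegral_prod]
    · rw [show b + (a 0 + ∑ i : Fin n, a i.succ) = a 0 + (b + ∑ i : Fin n, a i.succ) by ring,
        ← dg_conv (ha 0) hS hz]
      apply lintegral_congr_ae
      filter_upwards [show ∀ᵐ x : ℝ, x ≠ z from by simp [ae_iff]] with x hx
      rw [← ih (fun i => a i.succ) (fun i => ha _) b hb (z - x) (sub_ne_zero.2 hx.symm),
        ← lintegral_const_mul]
      · simp only [mul_assoc, sub_sub]
        rfl
      · refine Measurable.mul (Finset.measurable_prod _ fun i _ => (hm _).comp (by fun_prop))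
          ((hm _).comp (by fun_prop))
    · refine Measurable.aemeasurable ?_
      refine Measurable.mul (Measurable.mul ((hm _).comp (by fun_prop))
        (Finset.measurable_prod _ fun i _ => (hm _).comp ?_)) ((hm _).comp ?_)
      · simp; fun_prop
      · simp; fun_prop

lemma dg_fintype {ι : Type*} [Fintype ι] (a : ι → ℝ) (ha : ∀ i, 0 < a i) (b : ℝ) (hb : 0 < b)
    (z : ℝ) (hz : z ≠ 0) :
    ∫⁻ q : ι → ℝ, (∏ i, ENNReal.ofReal (dgDens (a i) (q i))) *
      ENNReal.ofReal (dgDens b (z - ∑ i, q i)) = ENNReal.ofReal (dgDens (b + ∑ i, a i) z) := by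
  let e := (Fintype.equivFin ι).symm
  rw [← (volume_measurePreserving_piCongrLeft (fun _ : ι => ℝ) e).lintegral_comp_emb
    (MeasurableEquiv.measurableEmbedding _), ← e.sum_comp a,
    ← dg_fin _ (fun i => a (e i)) (fun i => ha _) b hb z hz]
  congr 1
  ext q
  rw [← e.prod_comp, ← e.sum_comp]
  simp only [MeasurableEquiv.coe_piCongrLeft, Equiv.piCongrLeft_apply_apply]

open MeasureTheory Real

/-- Dirichlet integral identity: for a finite index set `D`, a vector `a : D → ℝ` with
`a i > 0`, `α = ∑ i, a i`, and `Z > 0`, the integral of `∏ i, p i ^ (a i - 1) / Γ (a i)`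
over the simplex `{p : D → ℝ≥0 | ∑ i, p i = Z}` — parametrized by the coordinates away
from a chosen index `i₀`, carrying the `(|D| - 1)`-dimensional Lebesgue measure —
equals `Z ^ (α - 1) / Γ α`. -/
theorem dirichlet_integral_identity
    {D : Type*} [Fintype D] [DecidableEq D] (i₀ : D)
    (a : D → ℝ) (ha : ∀ i, 0 < a i) (α : ℝ) (hα : α = ∑ i, a i)
    (Z : ℝ) (hZ : 0 < Z) :
    (∫ q : {i : D // i ≠ i₀} → ℝ in
        {q | (∀ i, 0 ≤ q i) ∧ (∑ i, q i) ≤ Z},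
        (∏ i : {i : D // i ≠ i₀}, (q i) ^ (a i.1 - 1) / Real.Gamma (a i.1)) *
          ((Z - ∑ i, q i) ^ (a i₀ - 1) / Real.Gamma (a i₀))) =
      Z ^ (α - 1) / Real.Gamma α := by
  have hset : MeasurableSet {q : {i : D // i ≠ i₀} → ℝ | (∀ i, 0 ≤ q i) ∧ (∑ i, q i) ≤ Z} := by
    have h2 : MeasurableSet {q : {i : D // i ≠ i₀} → ℝ | (∑ i, q i) ≤ Z} :=
      measurableSet_le (by fun_prop) (by fun_prop)
    have h1 : MeasurableSet {q : {i : D // i ≠ i₀} → ℝ | ∀ i, 0 ≤ q i} := by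
      rw [Set.ofPred_forall]
      exact MeasurableSet.iInter fun i => measurableSet_le (by fun_prop) (by fun_prop)
    exact h1.inter h2
  rw [← integral_indicator hset]
  have hpt : ∀ q : {i : D // i ≠ i₀} → ℝ,
      Set.indicator {q : {i : D // i ≠ i₀} → ℝ | (∀ i, 0 ≤ q i) ∧ (∑ i, q i) ≤ Z}
        (fun q => (∏ i : {i : D // i ≠ i₀}, (q i) ^ (a i.1 - 1) / Real.Gamma (a i.1)) *
          ((Z - ∑ i, q i) ^ (a i₀ - 1) / Real.Gamma (a i₀))) q =
      (∏ i : {i : D // i ≠ i₀}, dgDens (a i.1) (q i)) * dgDens (a i₀) (Z - ∑ i, q i) := by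
    intro q
    by_cases h1 : ∀ i, 0 ≤ q i
    · by_cases h2 : ∑ i, q i ≤ Z
      · rw [Set.indicator_of_mem (Set.mem_ofPred.2 ⟨h1, h2⟩)]
        simp only [dgDens, h1, if_true, sub_nonneg, h2]
      · rw [Set.indicator_of_notMem (fun h => h2 h.2)]
        simp only [dgDens, sub_nonneg, h2, if_false, mul_zero]
    · rw [Set.indicator_of_notMem (fun h => h1 h.1)]
      push Not at h1
      obtain ⟨i, hi⟩ := h1
      rw [Finset.prod_eq_zero (Finset.mem_univ i) (by simp [dgDens, hi.not_ge]), zero_mul]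
  simp_rw [hpt]
  rw [integral_eq_lintegral_of_nonneg_ae]
  · have hsum : a i₀ + ∑ i : {i : D // i ≠ i₀}, a i.1 = α := by
      rw [hα, Fintype.sum_eq_add_sum_subtype_ne a i₀]
    have hαpos : 0 < α := by
      rw [hα]
      exact Finset.sum_pos (fun i _ => ha i) ⟨i₀, Finset.mem_univ _⟩
    have := dg_fintype (fun i : {i : D // i ≠ i₀} => a i.1) (fun i => ha _) (a i₀) (ha _) Z hZ.ne'
    simp_rw [ENNReal.ofReal_mul (Finset.prod_nonneg fun i _ => dgDens_nonneg (ha _) _),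
      ENNReal.ofReal_prod_of_nonneg (fun i _ => dgDens_nonneg (ha _) _)]
    rw [this, hsum, ENNReal.toReal_ofReal (dgDens_nonneg hαpos _), dgDens, if_pos hZ.le]
  · exact ae_of_all _ fun q => mul_nonneg (Finset.prod_nonneg fun i _ => dgDens_nonneg (ha _) _)
      (dgDens_nonneg (ha _) _)
  · refine Measurable.aestronglyMeasurable ?_
    exact Measurable.mul (Finset.measurable_prod _ fun i _ =>
      (measurable_dgDens _).comp (by fun_prop)) ((measurable_dgDens _).comp (by fun_prop))
end

section
/- For all real z > 0, one has z² ψ'(z) < z + 1, with the representation z^{-1} + 1 - z ψ'(z) = ∫_0^∞ (t + e^{-t} - 1)/((e^t - 1)(1 - e^{-t})) e^{-tz} dt > 0. -/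
open MeasureTheory Real

/-- The trigamma function: second derivative of `log ∘ Γ`. -/
noncomputable def trigamma (z : ℝ) : ℝ :=
  iteratedDeriv 2 (fun x => Real.log (Real.Gamma x)) z

open Filter Topology in
lemma tri_summable (a : ℝ) (ha : 0 < a) : Summable (fun n : ℕ => 1 / (a + n) ^ 2) := by
  have h := (Real.summable_one_div_nat_add_rpow a 2).2 (by norm_num)
  refine h.congr (fun n => ?_)
  have : (0:ℝ) ≤ n := Nat.cast_nonneg n
  rw [abs_of_pos (by positivity), add_comm]
  norm_num

lemma tri_hasDeriv_D (z : ℝ) (hz : 0 < z) :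
    HasDerivAt (fun x : ℝ => ∑' n : ℕ, (1 / ((n : ℝ) + 1) - 1 / (x + n)))
      (∑' n : ℕ, 1 / (z + n) ^ 2) z := by
  set a := min (z / 2) (1 / 2) with ha
  have ha0 : 0 < a := by positivity
  have haz : a < z := lt_of_le_of_lt (min_le_left _ _) (by linarith)
  have ha1 : a < 1 := lt_of_le_of_lt (min_le_right _ _) (by norm_num)
  refine hasDerivAt_tsum_of_isPreconnected (t := Set.Ioi a) (y₀ := 1)
    (g := fun (n : ℕ) (x : ℝ) => 1 / ((n : ℝ) + 1) - 1 / (x + n))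
    (g' := fun (n : ℕ) (x : ℝ) => 1 / (x + n) ^ 2)
    (tri_summable a ha0) isOpen_Ioi isPreconnected_Ioi ?_ ?_ ha1 ?_ haz
  · intro n y hy
    have hy0 : 0 < y := ha0.trans hy
    have hn : (0:ℝ) ≤ n := Nat.cast_nonneg n
    have h1 : HasDerivAt (fun x : ℝ => x + n) 1 y := (hasDerivAt_id y).add_const _
    have h2 := (h1.inv (by positivity)).const_sub (1 / ((n : ℝ) + 1))
    convert h2 using 1
    · funext x; simp
    · ring
  · intro n y hy
    have hy0 : 0 < y := ha0.trans hy
    have hy1 : a < y := hy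
    have hn : (0:ℝ) ≤ n := Nat.cast_nonneg n
    rw [Real.norm_of_nonneg (by positivity)]
    gcongr
  · convert summable_zero with n
    rw [add_comm]; ring

lemma tri_L_aux (z : ℝ) (hz : 0 < z) :
    Summable (fun n : ℕ => (z - 1) / ((n : ℝ) + 1) - Real.log (z + n) + Real.log (n + 1)) ∧
    HasDerivAt (fun x : ℝ => ∑' n : ℕ, ((x - 1) / ((n : ℝ) + 1) - Real.log (x + n) + Real.log (n + 1)))
      (∑' n : ℕ, (1 / ((n : ℝ) + 1) - 1 / (z + n))) z := by
  set a := min (z / 2) (1 / 2) with ha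
  have ha0 : 0 < a := by positivity
  have haz : a < z := lt_of_le_of_lt (min_le_left _ _) (by linarith)
  have ha1 : a < 1 := lt_of_le_of_lt (min_le_right _ _) (by norm_num)
  have hu : Summable (fun n : ℕ => (z + 2) * (1 / (a + n) ^ 2)) := (tri_summable a ha0).mul_left _
  have hd : ∀ (n : ℕ) (y : ℝ), y ∈ Set.Ioo a (z + 2) →
      HasDerivAt (fun x : ℝ => (x - 1) / ((n : ℝ) + 1) - Real.log (x + n) + Real.log (n + 1))
        (1 / ((n : ℝ) + 1) - 1 / (y + n)) y := by
    intro n y hy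
    have hy0 : 0 < y := ha0.trans hy.1
    have hn : (0:ℝ) ≤ n := Nat.cast_nonneg n
    have h1 : HasDerivAt (fun x : ℝ => x + n) 1 y := (hasDerivAt_id y).add_const _
    have h2 : HasDerivAt (fun x : ℝ => x - 1) 1 y := (hasDerivAt_id y).sub_const _
    exact ((h2.div_const ((n : ℝ) + 1)).sub (h1.log (by positivity))).add_const _
  have hb : ∀ (n : ℕ) (y : ℝ), y ∈ Set.Ioo a (z + 2) →
      ‖1 / ((n : ℝ) + 1) - 1 / (y + n)‖ ≤ (z + 2) * (1 / (a + n) ^ 2) := by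
    intro n y hy
    have hy0 : 0 < y := ha0.trans hy.1
    have hy1 := hy.1
    have hy2 := hy.2
    have hn : (0:ℝ) ≤ n := Nat.cast_nonneg n
    have e : 1 / ((n : ℝ) + 1) - 1 / (y + n) = (y - 1) * (1 / (((n : ℝ) + 1) * (y + n))) := by
      field_simp; ring
    rw [e, norm_mul]
    gcongr
    · rw [Real.norm_eq_abs, abs_le]; constructor <;> linarith
    · rw [Real.norm_of_nonneg (by positivity), sq]
      refine one_div_le_one_div_of_le (by positivity) ?_
      exact mul_le_mul (by linarith) (by linarith) (by positivity) (by positivity)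
  have h0 : Summable fun n : ℕ =>
      (((1:ℝ) - 1) / ((n : ℝ) + 1) - Real.log (1 + n) + Real.log (n + 1)) := by
    convert summable_zero with n
    rw [add_comm (1:ℝ)]; ring
  have m1 : (1:ℝ) ∈ Set.Ioo a (z + 2) := ⟨ha1, by linarith⟩
  have mz : z ∈ Set.Ioo a (z + 2) := ⟨haz, by linarith⟩
  exact ⟨summable_of_summable_hasDerivAt_of_isPreconnected (g := fun (n : ℕ) (x : ℝ) => (x - 1) / ((n : ℝ) + 1) - Real.log (x + n) + Real.log (n + 1))
      (g' := fun (n : ℕ) (x : ℝ) => 1 / ((n : ℝ) + 1) - 1 / (x + n))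
      (t := Set.Ioo a (z + 2)) (y₀ := 1) (y := z) hu isOpen_Ioo isPreconnected_Ioo
      hd hb m1 h0 mz,
    hasDerivAt_tsum_of_isPreconnected (g := fun (n : ℕ) (x : ℝ) => (x - 1) / ((n : ℝ) + 1) - Real.log (x + n) + Real.log (n + 1))
      (g' := fun (n : ℕ) (x : ℝ) => 1 / ((n : ℝ) + 1) - 1 / (x + n))
      (t := Set.Ioo a (z + 2)) (y₀ := 1) (y := z) hu isOpen_Ioo isPreconnected_Ioo hd hb m1 h0 mz⟩

open Filter Topology in
lemma tri_logGamma (z : ℝ) (hz : 0 < z) :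
    Real.log (Real.Gamma z) =
      (∑' n : ℕ, ((z - 1) / ((n : ℝ) + 1) - Real.log (z + n) + Real.log (n + 1)))
        - (z - 1) * eulerMascheroniConstant := by
  have h1 := ((tri_L_aux z hz).1.hasSum.tendsto_sum_nat).comp (tendsto_add_atTop_nat 1)
  have h2 := Real.BohrMollerup.tendsto_log_gamma hz
  have h3 := (tendsto_harmonic_sub_log.comp (tendsto_add_atTop_nat 1)).const_mul (z - 1)
  have h4 : Tendsto (fun n : ℕ => z * (Real.log (n + 1) - Real.log n)) atTop (𝓝 (z * 0)) :=
    (Real.tendsto_log_nat_add_one_sub_log).const_mul z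
  have h5 := ((h1.sub h3).sub h4)
  rw [mul_zero, sub_zero] at h5
  refine tendsto_nhds_unique h2 (h5.congr (fun n => ?_))
  have hs : ∀ N : ℕ, ∑ i ∈ Finset.range N, ((z - 1) / ((i : ℝ) + 1) - Real.log (z + i) + Real.log (i + 1))
      = (z - 1) * (harmonic N : ℝ) - ∑ i ∈ Finset.range N, Real.log (z + i) + Real.log (N.factorial) := by
    intro N
    induction N with
    | zero => simp
    | succ N ih =>
      rw [Finset.sum_range_succ, ih, Finset.sum_range_succ, harmonic_succ, Nat.factorial_succ]
      push_cast
      rw [Real.log_mul (by positivity) (by positivity)]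
      ring
  simp only [Function.comp_apply, hs, Real.BohrMollerup.logGammaSeq, Nat.factorial_succ]
  push_cast
  rw [Real.log_mul (by positivity) (by positivity)]
  ring

open Filter Topology in
lemma tri_series (z : ℝ) (hz : 0 < z) : trigamma z = ∑' n : ℕ, 1 / (z + n) ^ 2 := by
  have hd : ∀ x : ℝ, 0 < x → HasDerivAt (fun x => Real.log (Real.Gamma x))
      ((∑' n : ℕ, (1 / ((n : ℝ) + 1) - 1 / (x + n))) - eulerMascheroniConstant) x := by
    intro x hx
    have h1 : HasDerivAt (fun x : ℝ => (x - 1) * eulerMascheroniConstant)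
        (1 * eulerMascheroniConstant) x := ((hasDerivAt_id x).sub_const 1).mul_const _
    have h2 := (tri_L_aux x hx).2.sub h1
    rw [one_mul] at h2
    refine h2.congr_of_eventuallyEq ?_
    filter_upwards [lt_mem_nhds hx] with y hy
    exact tri_logGamma y hy
  unfold trigamma
  rw [iteratedDeriv_succ, iteratedDeriv_one]
  refine HasDerivAt.deriv ?_
  refine ((tri_hasDeriv_D z hz).sub_const eulerMascheroniConstant).congr_of_eventuallyEq ?_
  filter_upwards [lt_mem_nhds hz] with y hy
  exact (hd y hy).deriv

open Filter Topology in
lemma tri_hasSum (z : ℝ) (hz : 0 < z) :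
    HasSum (fun n : ℕ => (n : ℝ) / ((z + n) ^ 2 * (z + n + 1))) (z⁻¹ + 1 - z * trigamma z) := by
  have h1 := ((tri_summable z hz).hasSum).mul_left z
  rw [← tri_series z hz] at h1
  have h2 : HasSum (fun n : ℕ => (((n + 1 : ℕ) : ℝ) - 1) / (z + (n + 1 : ℕ)) - ((n : ℝ) - 1) / (z + n))
      (z⁻¹ + 1) := by
    rw [hasSum_iff_tendsto_nat_of_nonneg]
    · have hl : Tendsto (fun n : ℕ => 1 - (1 + z) * (1 / (z + n))) atTop (𝓝 (1 - (1 + z) * 0)) := by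
        refine Tendsto.const_sub _ (Tendsto.const_mul _ ?_)
        simp only [one_div]
        exact (tendsto_atTop_add_const_left _ z tendsto_natCast_atTop_atTop).inv_tendsto_atTop
      have hl2 := hl.add_const z⁻¹
      rw [mul_zero, sub_zero, add_comm 1 z⁻¹] at hl2
      refine hl2.congr (fun n => ?_)
      rw [Finset.sum_range_sub (fun n : ℕ => ((n : ℝ) - 1) / (z + n))]
      have hn : (0:ℝ) ≤ n := Nat.cast_nonneg n
      have : z + n ≠ 0 := by positivity
      push_cast
      field_simp
      ring
    · intro n
      have hn : (0:ℝ) ≤ n := Nat.cast_nonneg n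
      have e : (((n + 1 : ℕ) : ℝ) - 1) / (z + (n + 1 : ℕ)) - ((n : ℝ) - 1) / (z + n)
        = (1 + z) / ((z + n) * (z + n + 1)) := by
        have : z + n ≠ 0 := by positivity
        have : z + n + 1 ≠ 0 := by positivity
        push_cast
        rw [← add_assoc]
        field_simp
        ring
      rw [e]; positivity
  refine (h2.sub h1).congr_fun (fun n => ?_)
  have hn : (0:ℝ) ≤ n := Nat.cast_nonneg n
  have : z + n ≠ 0 := by positivity
  have : z + n + 1 ≠ 0 := by positivity
  push_cast
  rw [← add_assoc]
  field_simp
  ring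

lemma tri_int (a : ℝ) (ha : 0 < a) :
    IntegrableOn (fun t : ℝ => (t + Real.exp (-t) - 1) * Real.exp (-a * t)) (Set.Ioi 0) ∧
    ∫ t in Set.Ioi (0 : ℝ), (t + Real.exp (-t) - 1) * Real.exp (-a * t) = 1 / (a ^ 2 * (a + 1)) := by
  have i1 : IntegrableOn (fun t : ℝ => t * Real.exp (-a * t)) (Set.Ioi 0) := by
    simpa using integrableOn_rpow_mul_exp_neg_mul_rpow (p := 1) (s := 1) (b := a)
      (by norm_num) (by norm_num) ha
  have i2 := integrableOn_exp_mul_Ioi (a := -(a + 1)) (by linarith) 0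
  have i3 := integrableOn_exp_mul_Ioi (a := -a) (by linarith) 0
  have e : (fun t : ℝ => (t + Real.exp (-t) - 1) * Real.exp (-a * t)) =
      fun t => (t * Real.exp (-a * t) + Real.exp (-(a + 1) * t)) - Real.exp (-a * t) := by
    funext t
    have : Real.exp (-(a + 1) * t) = Real.exp (-t) * Real.exp (-a * t) := by
      rw [← Real.exp_add]; ring_nf
    rw [this]; ring
  have v1 : ∫ t in Set.Ioi (0 : ℝ), t * Real.exp (-a * t) = 1 / a ^ 2 := by
    have := Real.integral_rpow_mul_exp_neg_mul_Ioi (a := 2) (r := a) (by norm_num) ha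
    norm_num at this
    simpa using this
  rw [e]
  have i12 : IntegrableOn (fun t : ℝ => t * Real.exp (-a * t) + Real.exp (-(a + 1) * t))
    (Set.Ioi 0) := i1.add i2
  refine ⟨i12.sub i3, ?_⟩
  rw [integral_sub i12 i3, integral_add i1 i2, v1, integral_exp_mul_Ioi (by linarith),
    integral_exp_mul_Ioi (by linarith)]
  simp only [mul_zero, Real.exp_zero]
  have : a + 1 ≠ 0 := by positivity
  have : -(a + 1) ≠ 0 := neg_ne_zero.mpr this
  field_simp
  ring

lemma tri_main (z : ℝ) (hz : 0 < z) :
    z⁻¹ + 1 - z * trigamma z =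
      (∫ t in Set.Ioi (0 : ℝ),
        (t + Real.exp (-t) - 1) / ((Real.exp t - 1) * (1 - Real.exp (-t))) * Real.exp (-t * z)) := by
  have hp : ∀ n : ℕ, 0 < z + n := fun n => by positivity
  have hI : ∀ n : ℕ, ∫ t in Set.Ioi (0 : ℝ),
      (n : ℝ) * ((t + Real.exp (-t) - 1) * Real.exp (-(z + n) * t)) =
      (n : ℝ) / ((z + n) ^ 2 * (z + n + 1)) := by
    intro n
    rw [integral_const_mul, (tri_int _ (hp n)).2]
    ring
  have hN : ∀ n : ℕ, ∫ t in Set.Ioi (0 : ℝ),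
      ‖(n : ℝ) * ((t + Real.exp (-t) - 1) * Real.exp (-(z + n) * t))‖ =
      (n : ℝ) / ((z + n) ^ 2 * (z + n + 1)) := by
    intro n
    rw [← hI n]
    refine setIntegral_congr_fun measurableSet_Ioi (fun t ht => ?_)
    refine Real.norm_of_nonneg ?_
    have := Real.add_one_le_exp (-t)
    have : 0 ≤ t + Real.exp (-t) - 1 := by linarith
    positivity
  have hs := hasSum_integral_of_summable_integral_norm (μ := volume.restrict (Set.Ioi (0:ℝ)))
    (F := fun (n : ℕ) (t : ℝ) => (n : ℝ) * ((t + Real.exp (-t) - 1) * Real.exp (-(z + n) * t)))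
    (fun n => (tri_int _ (hp n)).1.const_mul _)
    ((tri_hasSum z hz).summable.congr (fun n => (hN n).symm))
  simp only [hI] at hs
  rw [(tri_hasSum z hz).unique hs]
  refine setIntegral_congr_fun measurableSet_Ioi (fun t ht => ?_)
  have ht0 : 0 < t := ht
  have hlt : Real.exp (-t) < 1 := by rw [Real.exp_lt_one_iff]; linarith
  have hg := hasSum_coe_mul_geometric_of_norm_lt_one (r := Real.exp (-t))
    (by rw [Real.norm_of_nonneg (Real.exp_pos _).le]; exact hlt)
  have hg2 := hg.mul_left ((t + Real.exp (-t) - 1) * Real.exp (-t * z))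
  have e : ∀ n : ℕ, (n : ℝ) * ((t + Real.exp (-t) - 1) * Real.exp (-(z + n) * t)) =
      (t + Real.exp (-t) - 1) * Real.exp (-t * z) * (n * Real.exp (-t) ^ n) := by
    intro n
    rw [← Real.exp_nat_mul, show -(z + n) * t = -t * z + n * (-t) by ring, Real.exp_add]
    ring
  simp only [e]
  rw [hg2.tsum_eq]
  have h1 : 1 - Real.exp (-t) ≠ 0 := by linarith
  have h2 : Real.exp t - 1 = (1 - Real.exp (-t)) / Real.exp (-t) := by
    rw [Real.exp_neg]; field_simp
  rw [h2]
  have := Real.exp_pos (-t)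
  field_simp

/-- For all real `z > 0`, `z² ψ'(z) < z + 1`, with the representation
`z⁻¹ + 1 - z ψ'(z) = ∫_0^∞ (t + e^{-t} - 1)/((e^t - 1)(1 - e^{-t})) e^{-t z} dt > 0`. -/
theorem trigamma_sq_lt (z : ℝ) (hz : 0 < z) :
    z⁻¹ + 1 - z * trigamma z =
      (∫ t in Set.Ioi (0 : ℝ),
        (t + Real.exp (-t) - 1) / ((Real.exp t - 1) * (1 - Real.exp (-t))) * Real.exp (-t * z)) ∧
    0 < z⁻¹ + 1 - z * trigamma z ∧
    z ^ 2 * trigamma z < z + 1 := by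
  have hpos : 0 < z⁻¹ + 1 - z * trigamma z := by
    refine lt_of_lt_of_le ?_ (le_hasSum (tri_hasSum z hz) 1 (fun n _ => by positivity))
    positivity
  refine ⟨tri_main z hz, hpos, ?_⟩
  have h := mul_pos hz hpos
  have e : z * (z⁻¹ + 1 - z * trigamma z) = z + 1 - z ^ 2 * trigamma z := by
    field_simp
    ring
  rw [e] at h
  linarith
end
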